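/- (Proposition 2, case 1c) Assume J₁₁ > 0, J₁₂ < 0, set λ_M = J₁₁ − J₁₂, λ_m = J₁₁ + J₁₂, and suppose λ_m > 0. Let β̌ ∈ (0,1) be a solution of β̌·artanh(√(1−β̌))/√(1−β̌) = λ_m/λ_M. If 2/λ_m < β < 2/(β̌·λ_M), then f has exactly five critical points in (−1,1)²: the origin (0,0), the two points ±(x̃,−x̃) where x̃ is the unique solution in (0,1) of x = tanh((βλ_M/2)·x), and the two points ±(x̂,x̂) where x̂ is the unique solution in (0,1) of x = tanh((βλ_m/2)·x). The origin is a local minimum point, ±(x̃,−x̃) are local maximum points, and ±(x̂,x̂) are saddle (inflection) points of f. -/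

import Mathlib

/-- The entropy function 𝓘(x) = ((1+x)log(1+x) + (1-x)log(1-x))/2.
Note `Real.log 0 = 0` in Mathlib, which implements the convention 0·log 0 = 0. -/
noncomputable def entI (x : ℝ) : ℝ :=
  ((1 + x) * Real.log (1 + x) + (1 - x) * Real.log (1 - x)) / 2

/-- Pressure functional of the symmetric zero-field bipartite mean-field model
(α₁ = α₂ = 1/2, J₁₁ = J₂₂, h₁ = h₂ = 0). -/
noncomputable def fSym (β J11 J12 : ℝ) (μ : ℝ × ℝ) : ℝ :=
  β / 8 * (J11 * (μ.1 ^ 2 + μ.2 ^ 2) + 2 * J12 * μ.1 * μ.2) - (entI μ.1 + entI μ.2) / 2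

/-- A critical point of f: a point of the open square (−1,1)² where both partial
derivatives of f vanish. -/
def IsCritPt (β J11 J12 : ℝ) (μ : ℝ × ℝ) : Prop :=
  μ.1 ∈ Set.Ioo (-1 : ℝ) 1 ∧ μ.2 ∈ Set.Ioo (-1 : ℝ) 1 ∧
    deriv (fun x => fSym β J11 J12 (x, μ.2)) μ.1 = 0 ∧
    deriv (fun y => fSym β J11 J12 (μ.1, y)) μ.2 = 0

/-- The inverse hyperbolic tangent, artanh(x) = (1/2)·log((1+x)/(1−x)). -/
noncomputable def artanh (x : ℝ) : ℝ := (1 / 2) * Real.log ((1 + x) / (1 - x))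

open Set Filter Topology

lemma sinh_lt_mul_cosh {x : ℝ} (hx : 0 < x) : Real.sinh x < x * Real.cosh x := by
  have hd : ∀ y : ℝ, HasDerivAt (fun y => y * Real.cosh y - Real.sinh y) (y * Real.sinh y) y := by
    intro y
    have h := ((hasDerivAt_id y).mul (Real.hasDerivAt_cosh y)).sub (Real.hasDerivAt_sinh y)
    refine h.congr_deriv ?_
    simp only [id]
    ring
  have hmono : StrictMonoOn (fun y => y * Real.cosh y - Real.sinh y) (Ici 0) := by
    refine strictMonoOn_of_deriv_pos (convex_Ici 0)
      (fun y _ => (hd y).continuousAt.continuousWithinAt) fun y hy => ?_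
    rw [interior_Ici] at hy
    rw [(hd y).deriv]
    exact mul_pos hy (Real.sinh_pos_iff.2 hy)
  have := hmono self_mem_Ici hx.le hx
  simp only [Real.cosh_zero, Real.sinh_zero] at this
  linarith

/-- The function `sinh x / x` is strictly increasing on `(0, ∞)`. -/
lemma strictMonoOn_sinh_div_self : StrictMonoOn (fun x : ℝ => Real.sinh x / x) (Ioi 0) := by
  have hd : ∀ y ∈ Ioi (0 : ℝ), HasDerivAt (fun y => Real.sinh y / y)
      ((Real.cosh y * y - Real.sinh y * 1) / y ^ 2) y := fun y hy =>
    (Real.hasDerivAt_sinh y).div (hasDerivAt_id y) (ne_of_gt hy)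
  refine strictMonoOn_of_deriv_pos (convex_Ioi 0)
    (fun y hy => (hd y hy).continuousAt.continuousWithinAt) fun y hy => ?_
  rw [interior_Ioi] at hy
  rw [(hd y hy).deriv]
  have h0 : 0 < y := hy
  have := sinh_lt_mul_cosh h0
  exact div_pos (by linarith) (by positivity)

lemma self_lt_sinh_mul_cosh {x : ℝ} (hx : 0 < x) : x < Real.sinh x * Real.cosh x := by
  have h1 := Real.self_lt_sinh_iff.2 hx
  have h2 := Real.one_le_cosh x
  nlinarith

/-- The function `x * coth x` is strictly increasing on `(0, ∞)`. -/
lemma strictMonoOn_mul_coth :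
    StrictMonoOn (fun x : ℝ => x * Real.cosh x / Real.sinh x) (Ioi 0) := by
  have hd : ∀ y ∈ Ioi (0 : ℝ), HasDerivAt (fun y => y * Real.cosh y / Real.sinh y)
      (((1 * Real.cosh y + y * Real.sinh y) * Real.sinh y - y * Real.cosh y * Real.cosh y)
        / Real.sinh y ^ 2) y := fun y hy =>
    ((hasDerivAt_id y).mul (Real.hasDerivAt_cosh y)).div (Real.hasDerivAt_sinh y)
      (Real.sinh_pos_iff.2 hy).ne'
  refine strictMonoOn_of_deriv_pos (convex_Ioi 0)
    (fun y hy => (hd y hy).continuousAt.continuousWithinAt) fun y hy => ?_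
  rw [interior_Ioi] at hy
  rw [(hd y hy).deriv]
  have h0 : 0 < y := hy
  have h1 := Real.sinh_pos_iff.2 h0
  have h2 := self_lt_sinh_mul_cosh h0
  have h3 := Real.cosh_sq y
  refine div_pos ?_ (by positivity)
  have : (1 * Real.cosh y + y * Real.sinh y) * Real.sinh y - y * Real.cosh y * Real.cosh y
      = Real.sinh y * Real.cosh y - y := by linear_combination (-y) * h3
  rw [this]
  linarith

/-- For `1 < c` the equation `p = c * tanh p` has a unique positive solution. -/
lemma exists_unique_eq_mul_tanh {c : ℝ} (hc : 1 < c) :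
    ∃ p : ℝ, 0 < p ∧ p = c * Real.tanh p ∧ ∀ q : ℝ, 0 < q → q = c * Real.tanh q → q = p := by
  have hiff : ∀ q : ℝ, 0 < q → (q = c * Real.tanh q ↔ q * Real.cosh q / Real.sinh q = c) := by
    intro q hq
    have h1 := Real.sinh_pos_iff.2 hq
    have h2 := Real.cosh_pos q
    rw [Real.tanh_eq_sinh_div_cosh, div_eq_iff h1.ne', ← mul_div_assoc, eq_div_iff h2.ne']
  have harc := Real.arcosh_pos hc
  have hcosh := Real.cosh_arcosh hc.le
  set p₀ := Real.arcosh c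
  have hcont : ContinuousOn (fun p => p * Real.cosh p - c * Real.sinh p) (Icc p₀ (p₀ + c)) := by
    fun_prop
  have hlo : p₀ * Real.cosh p₀ - c * Real.sinh p₀ ≤ 0 := by
    have := Real.self_lt_sinh_iff.2 harc
    rw [hcosh]; nlinarith
  have hhi : 0 ≤ (p₀ + c) * Real.cosh (p₀ + c) - c * Real.sinh (p₀ + c) := by
    have h1 := Real.sinh_lt_cosh (p₀ + c)
    have h2 := Real.cosh_pos (p₀ + c)
    nlinarith
  obtain ⟨p, hp, hpe⟩ := intermediate_value_Icc (by linarith) hcont ⟨hlo, hhi⟩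
  have hp0 : 0 < p := harc.trans_le hp.1
  have hpD : p * Real.cosh p / Real.sinh p = c := by
    rw [div_eq_iff (Real.sinh_pos_iff.2 hp0).ne']
    change p * Real.cosh p - c * Real.sinh p = 0 at hpe
    linarith
  refine ⟨p, hp0, (hiff p hp0).2 hpD, fun q hq hqe => ?_⟩
  exact strictMonoOn_mul_coth.injOn hq hp0 (((hiff q hq).1 hqe).trans hpD.symm)

/-- Positive solutions of the hyperbolic form of the off-diagonal critical point equations
cannot exist below the bifurcation threshold `2 * M < 1 + cosh τ`. -/
lemma no_offdiagonal_solution {M m σ δ τ : ℝ} (hm : 0 < m)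
    (hσ : 0 < σ) (hδ : 0 < δ) (hτ : 0 < τ)
    (h1 : σ * (Real.cosh σ + Real.cosh δ) = 2 * m * Real.sinh σ)
    (h2 : δ * (Real.cosh σ + Real.cosh δ) = 2 * M * Real.sinh δ)
    (h3 : M * τ = m * Real.sinh τ) (h4 : 2 * M < 1 + Real.cosh τ) : False := by
  have sσ := Real.sinh_pos_iff.2 hσ
  have sδ := Real.sinh_pos_iff.2 hδ
  have sτ := Real.sinh_pos_iff.2 hτ
  have hSδ : 1 < Real.sinh δ / δ := by
    rw [one_lt_div hδ]; exact Real.self_lt_sinh_iff.2 hδ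
  have hSτ : 0 < Real.sinh τ / τ := by positivity
  have hS : Real.sinh σ / σ = Real.sinh τ / τ * (Real.sinh δ / δ) := by
    have e1 : Real.sinh τ / τ = M / m := by field_simp; linarith
    have e2 : 2 * M * (Real.sinh δ / δ) = Real.cosh σ + Real.cosh δ := by
      field_simp; linarith
    have e3 : 2 * m * (Real.sinh σ / σ) = Real.cosh σ + Real.cosh δ := by
      field_simp; linarith
    rw [e1]
    field_simp
    field_simp at e2 e3
    linear_combination (e3 * δ - e2 * σ) / 2
  have hlt : τ < σ := by
    rw [← strictMonoOn_sinh_div_self.lt_iff_lt hτ hσ]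
    rw [hS]
    nlinarith
  have hD := strictMonoOn_mul_coth hτ hσ hlt
  simp only at hD
  have hc1 : Real.cosh τ < Real.cosh σ / (Real.sinh δ / δ) := by
    have e : Real.cosh σ / (Real.sinh δ / δ)
        = Real.sinh τ / τ * (σ * Real.cosh σ / Real.sinh σ) := by
      have : Real.sinh δ / δ = Real.sinh σ / σ / (Real.sinh τ / τ) := by
        rw [hS]; field_simp
      rw [this]; field_simp
    have e' : Real.cosh τ = Real.sinh τ / τ * (τ * Real.cosh τ / Real.sinh τ) := by
      field_simp
    rw [e, e']
    exact mul_lt_mul_of_pos_left hD hSτ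
  have hc2 : 1 < Real.cosh δ / (Real.sinh δ / δ) := by
    rw [lt_div_iff₀ (by positivity), one_mul, div_lt_iff₀ hδ]
    linarith [sinh_lt_mul_cosh hδ]
  have : Real.cosh σ / (Real.sinh δ / δ) + Real.cosh δ / (Real.sinh δ / δ) = 2 * M := by
    field_simp; linarith
  linarith

/-- The diagonal solution is unstable in the antidiagonal direction below the threshold. -/
lemma cosh_sq_lt_of_diagonal_solution {M m p τ : ℝ} (hm : 0 < m) (hp : 0 < p) (hτ : 0 < τ)
    (h1 : p * Real.cosh p = m * Real.sinh p)
    (h3 : M * τ = m * Real.sinh τ) (h4 : 2 * M < 1 + Real.cosh τ) : Real.cosh p ^ 2 < M := by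
  by_contra! hM
  have sp := Real.sinh_pos_iff.2 hp
  have sτ := Real.sinh_pos_iff.2 hτ
  have sh := Real.sinh_pos_iff.2 (half_pos hτ)
  have cp := Real.cosh_pos p
  have e1 : Real.sinh τ = 2 * Real.sinh (τ / 2) * Real.cosh (τ / 2) := by
    rw [← Real.sinh_two_mul]; ring_nf
  have e2 : 1 + Real.cosh τ = 2 * Real.cosh (τ / 2) ^ 2 := by
    have : Real.cosh τ = Real.cosh (2 * (τ / 2)) := by ring_nf
    rw [this, Real.cosh_two_mul, Real.sinh_sq]; ring
  have hmeq : m = p * Real.cosh p / Real.sinh p := by field_simp; linarith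
  have hMeq : M = m * (Real.sinh τ / τ) := by field_simp; linarith
  have hle : τ ≤ 2 * p := by
    rw [← strictMonoOn_sinh_div_self.le_iff_le hτ (show (0 : ℝ) < 2 * p by linarith)]
    rw [Real.sinh_two_mul]
    have : M / m ≤ Real.cosh p ^ 2 / m := by gcongr
    calc Real.sinh τ / τ = M / m := by rw [hMeq]; field_simp
      _ ≤ Real.cosh p ^ 2 / m := this
      _ = _ := by rw [hmeq]; field_simp
  have hD := strictMonoOn_mul_coth.monotoneOn (half_pos hτ) hp (by linarith)
  rw [← hmeq] at hD
  have : Real.cosh (τ / 2) ^ 2 ≤ M := by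
    calc Real.cosh (τ / 2) ^ 2
        = τ / 2 * Real.cosh (τ / 2) / Real.sinh (τ / 2) * (Real.sinh τ / τ) := by
          rw [e1]; field_simp
      _ ≤ m * (Real.sinh τ / τ) := by gcongr
      _ = M := hMeq.symm
  linarith

lemma isLocalMin_and_not_isLocalMax {g g' : ℝ → ℝ} {x c : ℝ}
    (hg : ∀ᶠ y in 𝓝 x, HasDerivAt g (g' y) y) (h0 : g' x = 0) (hg' : HasDerivAt g' c x)
    (hc : 0 < c) : IsLocalMin g x ∧ ¬ IsLocalMax g x := by
  have he : deriv g =ᶠ[𝓝 x] g' := hg.mono fun y hy => hy.deriv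
  have hdd : deriv (deriv g) x = c := he.deriv_eq.trans hg'.deriv
  have hd : deriv g x = 0 := he.eq_of_nhds.trans h0
  have hmin : IsLocalMin g x :=
    isLocalMin_of_deriv_deriv_pos (by rw [hdd]; exact hc) hd hg.self_of_nhds.continuousAt
  refine ⟨hmin, fun hmax => ?_⟩
  have hconst : g =ᶠ[𝓝 x] fun _ => g x := by
    filter_upwards [hmin, hmax] with y h1 h2 using le_antisymm h2 h1
  have hz : deriv g =ᶠ[𝓝 x] fun _ => 0 := by
    simpa using hconst.deriv
  have : deriv (deriv g) x = 0 := by simpa using hz.deriv_eq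
  linarith

lemma isLocalMax_and_not_isLocalMin {g g' : ℝ → ℝ} {x c : ℝ}
    (hg : ∀ᶠ y in 𝓝 x, HasDerivAt g (g' y) y) (h0 : g' x = 0) (hg' : HasDerivAt g' c x)
    (hc : c < 0) : IsLocalMax g x ∧ ¬ IsLocalMin g x := by
  obtain ⟨h1, h2⟩ := isLocalMin_and_not_isLocalMax (g := fun y => -g y) (g' := fun y => -g' y)
    (hg.mono fun y hy => hy.neg) (by simp [h0]) hg'.neg (by linarith)
  exact ⟨by simpa using h1.neg, fun h => h2 h.neg⟩

lemma artanh_eq_log_sub_log {x : ℝ} (hx : x ∈ Ioo (-1 : ℝ) 1) :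
    artanh x = (Real.log (1 + x) - Real.log (1 - x)) / 2 := by
  rw [artanh, Real.log_div (by linarith [hx.1]) (by linarith [hx.2])]
  ring

lemma artanh_tanh (p : ℝ) : artanh (Real.tanh p) = p := by
  have h := Real.artanh_eq_half_log (x := Real.tanh p)
    ⟨(Real.neg_one_lt_tanh p).le, (Real.tanh_lt_one p).le⟩
  rw [artanh, ← h, Real.artanh_tanh]

lemma tanh_mem_Ioo (p : ℝ) : Real.tanh p ∈ Ioo (-1 : ℝ) 1 :=
  ⟨Real.neg_one_lt_tanh p, Real.tanh_lt_one p⟩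

lemma exists_tanh_eq {x : ℝ} (hx : x ∈ Ioo (-1 : ℝ) 1) : ∃ p, Real.tanh p = x :=
  ⟨Real.artanh x, Real.tanh_artanh hx⟩

lemma one_sub_tanh_sq (p : ℝ) : 1 - Real.tanh p ^ 2 = 1 / Real.cosh p ^ 2 := by
  have := Real.cosh_pos p
  rw [Real.tanh_eq_sinh_div_cosh, div_pow, Real.sinh_sq]
  field_simp
  ring

lemma tanh_pos {p : ℝ} (hp : 0 < p) : 0 < Real.tanh p := by
  rw [Real.tanh_eq_sinh_div_cosh]
  exact div_pos (Real.sinh_pos_iff.2 hp) (Real.cosh_pos p)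

lemma hasDerivAt_artanh {x : ℝ} (hx : x ∈ Ioo (-1 : ℝ) 1) :
    HasDerivAt artanh (1 / (1 - x ^ 2)) x := by
  have h1 : 1 + x ≠ 0 := by linarith [hx.1]
  have h2 : 1 - x ≠ 0 := by linarith [hx.2]
  have h3 : 1 - x ^ 2 ≠ 0 := by
    rw [show 1 - x ^ 2 = (1 + x) * (1 - x) by ring]; exact mul_ne_zero h1 h2
  have h := ((((hasDerivAt_id x).const_add 1).log h1).sub
    (((hasDerivAt_id x).const_sub 1).log h2)).div_const 2
  have he : artanh =ᶠ[𝓝 x] fun y => (Real.log (1 + id y) - Real.log (1 - id y)) / 2 := by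
    filter_upwards [isOpen_Ioo.mem_nhds hx] with y hy using artanh_eq_log_sub_log hy
  refine (h.congr_of_eventuallyEq he).congr_deriv ?_
  simp only [id]
  field_simp
  ring

lemma hasDerivAt_entI {x : ℝ} (hx : x ∈ Ioo (-1 : ℝ) 1) : HasDerivAt entI (artanh x) x := by
  have h1 : 1 + x ≠ 0 := by linarith [hx.1]
  have h2 : 1 - x ≠ 0 := by linarith [hx.2]
  have p1 := (hasDerivAt_id x).const_add 1
  have p2 := (hasDerivAt_id x).const_sub 1
  have h := ((p1.mul (p1.log h1)).add (p2.mul (p2.log h2))).div_const 2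
  rw [artanh_eq_log_sub_log hx]
  refine HasDerivAt.congr_deriv (f := entI) h ?_
  simp only [id]
  field_simp
  ring

lemma entI_neg (x : ℝ) : entI (-x) = entI x := by
  simp only [entI, sub_neg_eq_add, ← sub_eq_add_neg]
  ring

/-- The one-dimensional Curie–Weiss pressure with coupling `c`. -/
noncomputable def cwPressure (c x : ℝ) : ℝ := c / 2 * x ^ 2 - entI x

lemma hasDerivAt_cwPressure (c : ℝ) {x : ℝ} (hx : x ∈ Ioo (-1 : ℝ) 1) :
    HasDerivAt (cwPressure c) (c * x - artanh x) x := by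
  have h := (((hasDerivAt_id x).pow 2).const_mul (c / 2)).sub (hasDerivAt_entI hx)
  refine HasDerivAt.congr_deriv (f := cwPressure c) h ?_
  simp
  ring

lemma hasDerivAt_deriv_cwPressure (c : ℝ) {x : ℝ} (hx : x ∈ Ioo (-1 : ℝ) 1) :
    HasDerivAt (fun x => c * x - artanh x) (c - 1 / (1 - x ^ 2)) x := by
  refine HasDerivAt.congr_deriv (((hasDerivAt_id x).const_mul c).sub (hasDerivAt_artanh hx)) ?_
  rw [mul_one]

lemma isLocalMax_cwPressure {c x : ℝ} (hx : x ∈ Ioo (-1 : ℝ) 1) (h : artanh x = c * x)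
    (hc : c < 1 / (1 - x ^ 2)) :
    IsLocalMax (cwPressure c) x ∧ ¬ IsLocalMin (cwPressure c) x :=
  isLocalMax_and_not_isLocalMin
    (by filter_upwards [isOpen_Ioo.mem_nhds hx] with y hy using hasDerivAt_cwPressure c hy)
    (by simp [h]) (hasDerivAt_deriv_cwPressure c hx) (by linarith)

lemma isLocalMin_cwPressure {c x : ℝ} (hx : x ∈ Ioo (-1 : ℝ) 1) (h : artanh x = c * x)
    (hc : 1 / (1 - x ^ 2) < c) : IsLocalMin (cwPressure c) x :=
  (isLocalMin_and_not_isLocalMax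
    (by filter_upwards [isOpen_Ioo.mem_nhds hx] with y hy using hasDerivAt_cwPressure c hy)
    (by simp [h]) (hasDerivAt_deriv_cwPressure c hx) (by linarith)).1

lemma cwPressure_neg (c x : ℝ) : cwPressure c (-x) = cwPressure c x := by
  simp [cwPressure, entI_neg]

lemma fSym_eq_sub (β J11 J12 : ℝ) (μ : ℝ × ℝ) :
    fSym β J11 J12 μ = (cwPressure (β * (J11 - J12) / 2) μ.1
      + cwPressure (β * (J11 - J12) / 2) μ.2) / 2 - -(β * J12) / 8 * (μ.1 + μ.2) ^ 2 := by
  simp only [fSym, cwPressure]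
  ring

lemma fSym_eq_add (β J11 J12 : ℝ) (μ : ℝ × ℝ) :
    fSym β J11 J12 μ = (cwPressure (β * (J11 + J12) / 2) μ.1
      + cwPressure (β * (J11 + J12) / 2) μ.2) / 2 + -(β * J12) / 8 * (μ.1 - μ.2) ^ 2 := by
  simp only [fSym, cwPressure]
  ring

lemma isLocalMax_fSym_antidiagonal {β J11 J12 x : ℝ} (hb : β * J12 ≤ 0)
    (h : IsLocalMax (cwPressure (β * (J11 - J12) / 2)) x) :
    IsLocalMax (fSym β J11 J12) (x, -x) := by
  have h' : IsLocalMax (cwPressure (β * (J11 - J12) / 2)) (-x) := by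
    have ht : Tendsto (fun y : ℝ => -y) (𝓝 (-x)) (𝓝 x) := by
      simpa using (continuous_neg.tendsto (-x))
    filter_upwards [ht.eventually h] with y hy
    rw [cwPressure_neg] at hy ⊢
    exact hy
  have t1 := continuous_fst.tendsto (x, -x)
  have t2 := continuous_snd.tendsto (x, -x)
  filter_upwards [t1.eventually h, t2.eventually h'] with μ h1 h2
  rw [fSym_eq_sub, fSym_eq_sub]
  simp only at h1 h2 ⊢
  have : 0 ≤ -(β * J12) / 8 * (μ.1 + μ.2) ^ 2 := by
    have : 0 ≤ -(β * J12) := by linarith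
    positivity
  have e : x + -x = 0 := by ring
  rw [e]
  linarith

lemma isLocalMin_fSym_diagonal {β J11 J12 x : ℝ} (hb : β * J12 ≤ 0)
    (h : IsLocalMin (cwPressure (β * (J11 + J12) / 2)) x) :
    IsLocalMin (fSym β J11 J12) (x, x) := by
  have t1 := continuous_fst.tendsto (x, x)
  have t2 := continuous_snd.tendsto (x, x)
  filter_upwards [t1.eventually h, t2.eventually h] with μ h1 h2
  rw [fSym_eq_add, fSym_eq_add]
  simp only at h1 h2 ⊢
  have : 0 ≤ -(β * J12) / 8 * (μ.1 - μ.2) ^ 2 := by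
    have : 0 ≤ -(β * J12) := by linarith
    positivity
  rw [sub_self]
  linarith

lemma not_isLocalMin_fSym_diagonal {β J11 J12 x : ℝ}
    (h : ¬ IsLocalMin (cwPressure (β * (J11 + J12) / 2)) x) :
    ¬ IsLocalMin (fSym β J11 J12) (x, x) := by
  refine fun hf => h ?_
  have ht : Tendsto (fun y : ℝ => (y, y)) (𝓝 x) (𝓝 (x, x)) :=
    (continuous_id.prodMk continuous_id).tendsto x
  filter_upwards [ht.eventually hf] with y hy
  simp only [fSym_eq_add] at hy
  simp only [sub_self] at hy
  linarith

lemma not_isLocalMax_fSym_diagonal {β J11 J12 x : ℝ} (hx : x ∈ Ioo (-1 : ℝ) 1)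
    (hc : 1 / (1 - x ^ 2) < β * (J11 - J12) / 2) :
    ¬ IsLocalMax (fSym β J11 J12) (x, x) := by
  intro hf
  set m := β * (J11 + J12) / 2 with hm
  have t1 : Tendsto (fun s : ℝ => x + s) (𝓝 0) (𝓝 x) := by
    simpa using (continuous_const_add x).tendsto 0
  have t2 : Tendsto (fun s : ℝ => x - s) (𝓝 0) (𝓝 x) := by
    simpa using (continuous_sub_left x).tendsto 0
  have hg : ∀ᶠ s in 𝓝 (0 : ℝ), HasDerivAt (fun s => fSym β J11 J12 (x + s, x - s))
      (((m * (x + s) - artanh (x + s)) - (m * (x - s) - artanh (x - s))) / 2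
        - β * J12 * s) s := by
    filter_upwards [t1.eventually (isOpen_Ioo.mem_nhds hx),
      t2.eventually (isOpen_Ioo.mem_nhds hx)] with s h1 h2
    have d1 := (hasDerivAt_cwPressure m h1).comp_const_add x s
    have d2 := (hasDerivAt_cwPressure m h2).comp_const_sub x s
    have d3 := ((hasDerivAt_id s).pow 2).const_mul (-(β * J12) / 2)
    have d := ((d1.add d2).div_const 2).add d3
    refine (d.congr_of_eventuallyEq (Eventually.of_forall fun y => ?_)).congr_deriv ?_
    · simp only [fSym_eq_add, Pi.add_apply, Pi.pow_apply, id, ← hm]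
      ring
    · simp only [id]
      norm_num
      ring
  have hg' : HasDerivAt (fun s => ((m * (x + s) - artanh (x + s))
      - (m * (x - s) - artanh (x - s))) / 2 - β * J12 * s)
      (β * (J11 - J12) / 2 - 1 / (1 - x ^ 2)) 0 := by
    have d1 := HasDerivAt.comp_const_add x 0
      (by simpa only [add_zero] using hasDerivAt_deriv_cwPressure m hx)
    have d2 := HasDerivAt.comp_const_sub x 0
      (by simpa only [sub_zero] using hasDerivAt_deriv_cwPressure m hx)
    have d := ((d1.sub d2).div_const 2).sub ((hasDerivAt_id (0 : ℝ)).const_mul (β * J12))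
    refine HasDerivAt.congr_deriv d ?_
    rw [hm]
    ring
  have hmax : IsLocalMax (fun s => fSym β J11 J12 (x + s, x - s)) 0 := by
    have ht := t1.prodMk_nhds t2
    filter_upwards [ht.eventually hf] with s hs
    simpa using hs
  exact (isLocalMin_and_not_isLocalMax hg (by simp) hg' (by linarith)).2 hmax

lemma fSym_swap (β J11 J12 x y : ℝ) : fSym β J11 J12 (x, y) = fSym β J11 J12 (y, x) := by
  simp only [fSym]
  ring

lemma deriv_fSym_fst (β J11 J12 y : ℝ) {x : ℝ} (hx : x ∈ Ioo (-1 : ℝ) 1) :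
    deriv (fun x => fSym β J11 J12 (x, y)) x = β / 4 * (J11 * x + J12 * y) - artanh x / 2 := by
  have d1 := ((hasDerivAt_id x).pow 2).const_mul (β / 8 * J11)
  have d2 := (hasDerivAt_id x).const_mul (β / 4 * J12 * y)
  have d := (((d1.add d2).sub ((hasDerivAt_entI hx).div_const 2)).add_const
    (β / 8 * J11 * y ^ 2 - entI y / 2))
  have d' : HasDerivAt (fun x => fSym β J11 J12 (x, y)) _ x :=
    d.congr_of_eventuallyEq (Eventually.of_forall fun z => by simp [fSym]; ring)
  rw [d'.deriv]
  simp
  ring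

lemma isCritPt_iff {β J11 J12 : ℝ} {μ : ℝ × ℝ} :
    IsCritPt β J11 J12 μ ↔ μ.1 ∈ Ioo (-1 : ℝ) 1 ∧ μ.2 ∈ Ioo (-1 : ℝ) 1 ∧
      artanh μ.1 = β / 2 * (J11 * μ.1 + J12 * μ.2) ∧
      artanh μ.2 = β / 2 * (J11 * μ.2 + J12 * μ.1) := by
  refine and_congr_right fun h1 => and_congr_right fun h2 => and_congr ?_ ?_
  · rw [deriv_fSym_fst _ _ _ _ h1]
    constructor <;> intro h <;> linarith
  · simp_rw [fSym_swap β J11 J12 μ.1]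
    rw [deriv_fSym_fst _ _ _ _ h2]
    constructor <;> intro h <;> linarith

lemma lt_cosh_sq_of_eq_mul_tanh {c p : ℝ} (hp : 0 < p) (h : p = c * Real.tanh p) :
    c < Real.cosh p ^ 2 := by
  have hc := Real.cosh_pos p
  have hs := Real.sinh_pos_iff.2 hp
  rw [Real.tanh_eq_sinh_div_cosh, ← mul_div_assoc, eq_div_iff hc.ne'] at h
  have := self_lt_sinh_mul_cosh hp
  nlinarith

lemma eq_zero_or_eq_or_eq_neg {c p r : ℝ}
    (huniq : ∀ q : ℝ, 0 < q → q = c * Real.tanh q → q = p) (hr : r = c * Real.tanh r) :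
    r = 0 ∨ r = p ∨ r = -p := by
  rcases lt_trichotomy r 0 with h | h | h
  · have := huniq (-r) (by linarith) (by rw [Real.tanh_neg]; linarith)
    right; right; linarith
  · exact Or.inl h
  · exact Or.inr (Or.inl (huniq r h hr))

lemma eq_neg_or_eq_of_tanh_equations {M m r s τ : ℝ} (hm : 0 < m) (hM : 0 < M) (hτ : 0 < τ)
    (h1 : r + s = m * (Real.tanh r + Real.tanh s)) (h2 : r - s = M * (Real.tanh r - Real.tanh s))
    (h3 : M * τ = m * Real.sinh τ) (h4 : 2 * M < 1 + Real.cosh τ) : s = -r ∨ r = s := by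
  by_contra! hne
  have hσ : r + s ≠ 0 := fun h => hne.1 (by linarith)
  have hδ : r - s ≠ 0 := fun h => hne.2 (by linarith)
  have cr := Real.cosh_pos r
  have cs := Real.cosh_pos s
  have hK : Real.cosh (r + s) + Real.cosh (r - s) = 2 * (Real.cosh r * Real.cosh s) := by
    rw [Real.cosh_add, Real.cosh_sub]; ring
  have hKpos : 0 < Real.cosh (r + s) + Real.cosh (r - s) := by rw [hK]; positivity
  rw [Real.tanh_eq_sinh_div_cosh, Real.tanh_eq_sinh_div_cosh] at h1 h2
  have e1 : (r + s) * (Real.cosh (r + s) + Real.cosh (r - s)) = 2 * m * Real.sinh (r + s) := by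
    rw [hK, Real.sinh_add]
    field_simp at h1
    linear_combination 2 * h1
  have e2 : (r - s) * (Real.cosh (r + s) + Real.cosh (r - s)) = 2 * M * Real.sinh (r - s) := by
    rw [hK, Real.sinh_sub]
    field_simp at h2
    linear_combination 2 * h2
  refine no_offdiagonal_solution hm (abs_pos.2 hσ) (abs_pos.2 hδ) hτ ?_ ?_ h3 h4 <;>
    rw [Real.cosh_abs, Real.cosh_abs]
  · have := congrArg abs e1
    rwa [abs_mul, abs_mul, Real.abs_sinh, abs_of_pos hKpos,
      abs_of_pos (show 0 < 2 * m by linarith)] at this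
  · have := congrArg abs e2
    rwa [abs_mul, abs_mul, Real.abs_sinh, abs_of_pos hKpos,
      abs_of_pos (show 0 < 2 * M by linarith)] at this

/-- Proposition 2, case 1c: for J₁₁ > 0, J₁₂ < 0, λ_M = J₁₁ − J₁₂, λ_m = J₁₁ + J₁₂ > 0,
and β̌ ∈ (0,1) solving β̌·artanh(√(1−β̌))/√(1−β̌) = λ_m/λ_M, if 2/λ_m < β < 2/(β̌λ_M) then
f has exactly five critical points: (0,0) (a local minimum), ±(x̃,−x̃) (local maxima) and
±(x̂,x̂) (saddle points). -/
theorem prop2_case1c (β J11 J12 βch : ℝ) (hJ11 : 0 < J11) (hJ12 : J12 < 0)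
    (hlm : 0 < J11 + J12) (hβ0 : 0 < β)
    (hβch : βch ∈ Set.Ioo (0 : ℝ) 1)
    (hβcheq : βch * artanh (Real.sqrt (1 - βch)) / Real.sqrt (1 - βch)
      = (J11 + J12) / (J11 - J12))
    (hβlo : 2 / (J11 + J12) < β) (hβhi : β < 2 / (βch * (J11 - J12))) :
    ∃ xt xh : ℝ, xt ∈ Set.Ioo (0 : ℝ) 1 ∧ xh ∈ Set.Ioo (0 : ℝ) 1 ∧
      xt = Real.tanh (β * (J11 - J12) / 2 * xt) ∧
      (∀ y ∈ Set.Ioo (0 : ℝ) 1, y = Real.tanh (β * (J11 - J12) / 2 * y) → y = xt) ∧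
      xh = Real.tanh (β * (J11 + J12) / 2 * xh) ∧
      (∀ y ∈ Set.Ioo (0 : ℝ) 1, y = Real.tanh (β * (J11 + J12) / 2 * y) → y = xh) ∧
      {μ : ℝ × ℝ | IsCritPt β J11 J12 μ}
        = {(0, 0), (xt, -xt), (-xt, xt), (xh, xh), (-xh, -xh)} ∧
      IsLocalMin (fSym β J11 J12) (0, 0) ∧
      IsLocalMax (fSym β J11 J12) (xt, -xt) ∧ IsLocalMax (fSym β J11 J12) (-xt, xt) ∧
      (¬ IsLocalMax (fSym β J11 J12) (xh, xh) ∧ ¬ IsLocalMin (fSym β J11 J12) (xh, xh)) ∧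
      (¬ IsLocalMax (fSym β J11 J12) (-xh, -xh) ∧
        ¬ IsLocalMin (fSym β J11 J12) (-xh, -xh)) := by
  have hlM : 0 < J11 - J12 := by linarith
  set M := β * (J11 - J12) / 2 with hM
  set m := β * (J11 + J12) / 2 with hm
  have hm1 : 1 < m := by
    rw [div_lt_iff₀ hlm] at hβlo
    rw [hm]; linarith
  have hmM : m < M := by rw [hM, hm]; nlinarith
  have hb : β * J12 ≤ 0 := by nlinarith
  have hMβ : M * βch < 1 := by
    rw [lt_div_iff₀ (mul_pos hβch.1 hlM)] at hβhi
    rw [hM]; linarith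
  obtain ⟨t, ht, hMt, hMc⟩ : ∃ t : ℝ, 0 < t ∧ M * t = m * Real.sinh t ∧
      2 * M < 1 + Real.cosh t := by
    have hs0 : 0 < Real.sqrt (1 - βch) := Real.sqrt_pos.2 (by linarith [hβch.2])
    have hs1 : Real.sqrt (1 - βch) < 1 := by
      rw [Real.sqrt_lt' one_pos]; linarith [hβch.1]
    have hsq : Real.sqrt (1 - βch) ^ 2 = 1 - βch := Real.sq_sqrt (by linarith [hβch.2])
    obtain ⟨u, hu⟩ := exists_tanh_eq ⟨by linarith, hs1⟩
    rw [← hu] at hs0 hsq hβcheq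
    have hu0 : 0 < u := by
      by_contra! h
      have := Real.sinh_nonpos_iff.2 h
      rw [Real.tanh_eq_sinh_div_cosh] at hs0
      exact absurd hs0 (not_lt.2 (div_nonpos_of_nonpos_of_nonneg this (Real.cosh_pos u).le))
    have hβu : βch = 1 / Real.cosh u ^ 2 := by rw [← one_sub_tanh_sq, hsq]; ring
    have hc := Real.cosh_pos u
    have hsh := Real.sinh_pos_iff.2 hu0
    rw [artanh_tanh, hβu, Real.tanh_eq_sinh_div_cosh] at hβcheq
    refine ⟨2 * u, by linarith, ?_, ?_⟩
    · rw [Real.sinh_two_mul]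
      field_simp at hβcheq
      rw [hM, hm]
      linear_combination β * hβcheq
    · rw [Real.cosh_two_mul, ← add_assoc, add_comm 1, add_assoc, ← Real.cosh_sq']
      rw [hβu, mul_one_div, div_lt_one (by positivity)] at hMβ
      linarith
  obtain ⟨p, hp, hpe, hpu⟩ := exists_unique_eq_mul_tanh (hm1.trans hmM)
  obtain ⟨q, hq, hqe, hqu⟩ := exists_unique_eq_mul_tanh hm1
  have hxt := tanh_mem_Ioo p
  have hxh := tanh_mem_Ioo q
  have hat : artanh (Real.tanh p) = M * Real.tanh p := by rw [artanh_tanh]; exact hpe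
  have hah : artanh (Real.tanh q) = m * Real.tanh q := by rw [artanh_tanh]; exact hqe
  have hpe' : p = β * (J11 - J12) / 2 * Real.tanh p := hpe
  have hqe' : q = β * (J11 + J12) / 2 * Real.tanh q := hqe
  have hneg : ∀ r, artanh (-Real.tanh r) = -r := fun r => by rw [← Real.tanh_neg, artanh_tanh]
  have hmemneg : ∀ r, -Real.tanh r ∈ Ioo (-1 : ℝ) 1 := fun r => by
    rw [← Real.tanh_neg]; exact tanh_mem_Ioo _
  have hMp : M < 1 / (1 - Real.tanh p ^ 2) := by
    rw [one_sub_tanh_sq, one_div_one_div]; exact lt_cosh_sq_of_eq_mul_tanh hp hpe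
  have hmq : m < 1 / (1 - Real.tanh q ^ 2) := by
    rw [one_sub_tanh_sq, one_div_one_div]; exact lt_cosh_sq_of_eq_mul_tanh hq hqe
  have hMq : 1 / (1 - Real.tanh q ^ 2) < M := by
    rw [one_sub_tanh_sq, one_div_one_div]
    refine cosh_sq_lt_of_diagonal_solution (by linarith) hq ht ?_ hMt hMc
    have := Real.cosh_pos q
    rw [Real.tanh_eq_sinh_div_cosh] at hqe
    field_simp at hqe
    linarith
  have hmax : IsLocalMax (fSym β J11 J12) (Real.tanh p, -Real.tanh p) :=
    isLocalMax_fSym_antidiagonal hb (isLocalMax_cwPressure hxt hat hMp).1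
  refine ⟨Real.tanh p, Real.tanh q, ⟨tanh_pos hp, hxt.2⟩, ⟨tanh_pos hq, hxh.2⟩,
    by rw [← hpe], fun y hy hye => ?_, by rw [← hqe], fun y hy hye => ?_, ?_, ?_, hmax, ?_,
    ⟨not_isLocalMax_fSym_diagonal hxh hMq,
      not_isLocalMin_fSym_diagonal (isLocalMax_cwPressure hxh hah hmq).2⟩,
    ⟨not_isLocalMax_fSym_diagonal (hmemneg q) (by rw [neg_sq]; exact hMq),
      not_isLocalMin_fSym_diagonal (isLocalMax_cwPressure (hmemneg q) ?_ ?_).2⟩⟩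
  · rw [← hpu (M * y) (mul_pos (by linarith) hy.1) (by rw [← hye])]; exact hye
  · rw [← hqu (m * y) (mul_pos (by linarith) hy.1) (by rw [← hye])]; exact hye
  · ext ⟨x, y⟩
    simp only [mem_ofPred_eq, isCritPt_iff, mem_insert_iff, mem_singleton_iff, Prod.mk.injEq]
    constructor
    · rintro ⟨hx, hy, h1, h2⟩
      obtain ⟨r, rfl⟩ := exists_tanh_eq hx
      obtain ⟨s, rfl⟩ := exists_tanh_eq hy
      rw [artanh_tanh] at h1 h2
      rcases eq_neg_or_eq_of_tanh_equations (by linarith) (by linarith) ht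
        (show r + s = m * (Real.tanh r + Real.tanh s) by rw [hm]; linarith)
        (show r - s = M * (Real.tanh r - Real.tanh s) by rw [hM]; linarith) hMt hMc with h | h
      · subst h
        rw [Real.tanh_neg] at h1
        rcases eq_zero_or_eq_or_eq_neg hpu (show r = M * Real.tanh r by rw [hM]; linarith)
          with h | h | h <;> simp [h]
      · subst h
        rcases eq_zero_or_eq_or_eq_neg hqu (show r = m * Real.tanh r by rw [hm]; linarith)
          with h | h | h <;> simp [h]
    · rintro (⟨rfl, rfl⟩ | ⟨rfl, rfl⟩ | ⟨rfl, rfl⟩ | ⟨rfl, rfl⟩ | ⟨rfl, rfl⟩)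
      · simp [artanh]
      · exact ⟨hxt, hmemneg p, by rw [artanh_tanh]; linarith, by rw [hneg]; linarith⟩
      · exact ⟨hmemneg p, hxt, by rw [hneg]; linarith, by rw [artanh_tanh]; linarith⟩
      · exact ⟨hxh, hxh, by rw [artanh_tanh]; linarith, by rw [artanh_tanh]; linarith⟩
      · exact ⟨hmemneg q, hmemneg q, by rw [hneg]; linarith, by rw [hneg]; linarith⟩
  · exact isLocalMin_fSym_diagonal hb
      (isLocalMin_cwPressure (by simp) (by simp [artanh]) (by simpa using hm1))
  · have := isLocalMax_fSym_antidiagonal hb (isLocalMax_cwPressure (hmemneg p)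
      (show artanh (-Real.tanh p) = M * -Real.tanh p by rw [hneg]; linarith) (by rwa [neg_sq])).1
    rwa [neg_neg] at this
  · rw [hneg]; linarith
  · rwa [neg_sq]
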